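/- arXiv:0906.0195 — 4 statements merged into one kernel-verified Lean document; each statement's English description precedes it below -/
import Mathlib

section
/- Let X be an s-distance set on the unit sphere S^{d-1} in ℝ^d (with d ≥ 2, s ≥ 1). Then |X| ≤ C(d+s-1, s) + C(d+s-2, s-1), where C(n,k) denotes the binomial coefficient. -/
open scoped RealInnerProductSpace

/-- The set of inner products between distinct points of a finite subset of `ℝ^d`. -/
noncomputable def innerSet {d : ℕ} (X : Finset (EuclideanSpace ℝ (Fin d))) : Finset ℝ :=
  haveI := Classical.decEq (EuclideanSpace ℝ (Fin d))
  haveI := Classical.decEq ℝ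
  X.offDiag.image (fun p => ⟪p.1, p.2⟫)

/-- The span of the monomials of degree `k` in the coordinates, as functions on the family of
points `p`. -/
def homogeneousSpan {d : ℕ} {ι : Type*} (p : ι → EuclideanSpace ℝ (Fin d)) (k : ℕ) :
    Submodule ℝ (ι → ℝ) :=
  Submodule.span ℝ (Set.range fun (m : Sym (Fin d) k) (x : ι) =>
    ((m : Multiset (Fin d)).map (p x)).prod)

section homogeneousSpan

variable {d : ℕ} {ι : Type*} (p : ι → EuclideanSpace ℝ (Fin d))

lemma finrank_homogeneousSpan_le (k : ℕ) :
    Module.finrank ℝ (homogeneousSpan p k) ≤ (d + k - 1).choose k := by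
  refine (finrank_range_le_card _).trans ?_
  rw [Sym.card_sym_eq_choose, Fintype.card_fin]

lemma one_mem_homogeneousSpan_zero : (1 : ι → ℝ) ∈ homogeneousSpan p 0 := by
  refine Submodule.subset_span ⟨Sym.nil, ?_⟩
  ext x
  simp

lemma coord_mul_mem_homogeneousSpan (i : Fin d) {k : ℕ} {f : ι → ℝ}
    (hf : f ∈ homogeneousSpan p k) :
    (fun x => p x i) * f ∈ homogeneousSpan p (k + 1) := by
  suffices homogeneousSpan p k ≤
      (homogeneousSpan p (k + 1)).comap (LinearMap.mulLeft ℝ (fun x => p x i)) from this hf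
  refine Submodule.span_le.2 ?_
  rintro _ ⟨m, rfl⟩
  refine Submodule.subset_span ⟨i ::ₛ m, ?_⟩
  ext x
  simp [Sym.coe_cons]

lemma inner_mul_mem_homogeneousSpan (v : EuclideanSpace ℝ (Fin d)) {k : ℕ} {f : ι → ℝ}
    (hf : f ∈ homogeneousSpan p k) :
    (fun x => ⟪v, p x⟫) * f ∈ homogeneousSpan p (k + 1) := by
  have h : (fun x => ⟪v, p x⟫) * f = ∑ i, v i • ((fun x => p x i) * f) := by
    ext x
    simp only [PiLp.inner_apply, Pi.mul_apply, Finset.sum_apply, Pi.smul_apply, smul_eq_mul,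
      Finset.sum_mul, RCLike.inner_apply, conj_trivial]
    exact Finset.sum_congr rfl fun i _ => by ring
  rw [h]
  exact Submodule.sum_mem _ fun i _ =>
    Submodule.smul_mem _ _ (coord_mul_mem_homogeneousSpan p i hf)

variable {p}

lemma homogeneousSpan_le_add_two (hp : ∀ x, ‖p x‖ = 1) (k : ℕ) :
    homogeneousSpan p k ≤ homogeneousSpan p (k + 2) := by
  intro f hf
  have h : f = ∑ i, (fun x => p x i) * ((fun x => p x i) * f) := by
    ext x
    have hx := EuclideanSpace.real_norm_sq_eq (p x)
    simp only [hp x, one_pow] at hx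
    simp only [Finset.sum_apply, Pi.mul_apply, ← mul_assoc (p x _), ← Finset.sum_mul, ← sq]
    rw [← hx, one_mul]
  rw [h]
  exact Submodule.sum_mem _ fun i _ =>
    coord_mul_mem_homogeneousSpan p i (coord_mul_mem_homogeneousSpan p i hf)

lemma prod_inner_sub_mem (hp : ∀ x, ‖p x‖ = 1) (v : EuclideanSpace ℝ (Fin d)) (t : Finset ℝ) :
    (fun x => ∏ a ∈ t, (⟪v, p x⟫ - a)) ∈
      homogeneousSpan p t.card ⊔ homogeneousSpan p (t.card - 1) := by
  classical
  induction t using Finset.induction_on with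
  | empty =>
    exact Submodule.mem_sup_left (one_mem_homogeneousSpan_zero p)
  | insert a t ha ih =>
    rw [Finset.card_insert_of_notMem ha, Nat.add_sub_cancel]
    obtain ⟨f, hf, g, hg, hfg⟩ := Submodule.mem_sup.1 ih
    have h : (fun x => ∏ b ∈ insert a t, (⟪v, p x⟫ - b)) =
        (fun x => ⟪v, p x⟫) * f + (fun x => ⟪v, p x⟫) * g - a • f - a • g := by
      ext x
      have hx := congrFun hfg x
      simp only [Pi.add_apply] at hx
      simp only [Finset.prod_insert ha, ← hx, Pi.add_apply, Pi.sub_apply, Pi.mul_apply,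
        Pi.smul_apply, smul_eq_mul]
      ring
    have hvf := inner_mul_mem_homogeneousSpan p v hf
    have hvg := inner_mul_mem_homogeneousSpan p v hg
    rw [h]
    refine sub_mem (sub_mem (add_mem (Submodule.mem_sup_left hvf) ?_)
      (Submodule.mem_sup_right (Submodule.smul_mem _ _ hf))) ?_
    · rcases Nat.eq_zero_or_pos t.card with h0 | h0
      · simp only [h0] at hvg ⊢
        exact Submodule.mem_sup_left hvg
      · rw [Nat.sub_add_cancel h0] at hvg
        exact Submodule.mem_sup_right hvg
    · refine Submodule.smul_mem _ _ ?_
      rcases Nat.eq_zero_or_pos t.card with h0 | h0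
      · simp only [h0] at hg ⊢
        exact Submodule.mem_sup_right hg
      · have hle := homogeneousSpan_le_add_two hp (t.card - 1)
        rw [show t.card - 1 + 2 = t.card + 1 by omega] at hle
        exact Submodule.mem_sup_left (hle hg)

end homogeneousSpan

lemma inner_mem_innerSet {d : ℕ} {X : Finset (EuclideanSpace ℝ (Fin d))}
    {x y : EuclideanSpace ℝ (Fin d)} (hx : x ∈ X) (hy : y ∈ X) (hxy : x ≠ y) :
    ⟪x, y⟫ ∈ innerSet X := by
  classical
  exact Finset.mem_image.2 ⟨(x, y), Finset.mem_offDiag.2 ⟨hx, hy, hxy⟩, rfl⟩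

lemma one_notMem_innerSet {d : ℕ} {X : Finset (EuclideanSpace ℝ (Fin d))}
    (hX : ∀ x ∈ X, ‖x‖ = 1) : (1 : ℝ) ∉ innerSet X := by
  classical
  intro h
  obtain ⟨⟨x, y⟩, hxy, h1⟩ := Finset.mem_image.1 h
  obtain ⟨hx, hy, hne⟩ := Finset.mem_offDiag.1 hxy
  exact hne ((inner_eq_one_iff_of_norm_eq_one (hX x hx) (hX y hy)).1 h1)

/-- **Fisher type inequality.** If `X` is an `s`-distance set on the unit sphere
`S^{d-1} ⊆ ℝ^d` (`d ≥ 2`, `s ≥ 1`), then `|X| ≤ C(d+s-1, s) + C(d+s-2, s-1)`. -/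
theorem fisher_type_inequality (d s : ℕ) (hd : 2 ≤ d) (hs : 1 ≤ s)
    (X : Finset (EuclideanSpace ℝ (Fin d)))
    (hsphere : ∀ x ∈ X, ‖x‖ = 1)
    (hdist : (innerSet X).card = s) :
    X.card ≤ Nat.choose (d + s - 1) s + Nat.choose (d + s - 2) (s - 1) := by
  classical
  let p : X → EuclideanSpace ℝ (Fin d) := Subtype.val
  have hp : ∀ x, ‖p x‖ = 1 := fun x => hsphere x x.2
  have htop : homogeneousSpan p s ⊔ homogeneousSpan p (s - 1) = ⊤ := by
    rw [eq_top_iff, ← (Pi.basisFun ℝ X).span_eq, Submodule.span_le]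
    rintro _ ⟨x, rfl⟩
    have hmem := prod_inner_sub_mem hp (p x) (innerSet X)
    rw [hdist] at hmem
    have hc : ∏ a ∈ innerSet X, ((1 : ℝ) - a) ≠ 0 :=
      Finset.prod_ne_zero_iff.2 fun a ha h =>
        one_notMem_innerSet hsphere (sub_eq_zero.1 h ▸ ha)
    have hsingle : Pi.basisFun ℝ X x = (∏ a ∈ innerSet X, ((1 : ℝ) - a))⁻¹ •
        fun y => ∏ a ∈ innerSet X, (⟪p x, p y⟫ - a) := by
      ext y
      rw [Pi.basisFun_apply, Pi.smul_apply, smul_eq_mul]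
      by_cases hxy : x = y
      · subst hxy
        rw [Pi.single_eq_same, real_inner_self_eq_norm_sq, hp, one_pow, inv_mul_cancel₀ hc]
      · have hne : p x ≠ p y := fun h => hxy (Subtype.ext h)
        rw [Pi.single_eq_of_ne (Ne.symm hxy),
          Finset.prod_eq_zero (inner_mem_innerSet x.2 y.2 hne) (sub_self _), mul_zero]
    rw [hsingle]
    exact Submodule.smul_mem _ _ hmem
  have hs' : d + (s - 1) - 1 = d + s - 2 := by omega
  calc X.card = Module.finrank ℝ (⊤ : Submodule ℝ (X → ℝ)) := by simp
    _ ≤ Module.finrank ℝ (homogeneousSpan p s) +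
        Module.finrank ℝ (homogeneousSpan p (s - 1)) :=
      htop ▸ Submodule.finrank_add_le_finrank_add_finrank _ _
    _ ≤ (d + s - 1).choose s + (d + s - 2).choose (s - 1) :=
      add_le_add (finrank_homogeneousSpan_le p s)
        (hs' ▸ finrank_homogeneousSpan_le p (s - 1))
end

section
/- Let X be an antipodal s-distance set on the unit sphere S^{d-1} in ℝ^d (with d ≥ 2, s ≥ 1). Then |X| ≤ 2·C(d+s-2, s-1), where C(n,k) denotes the binomial coefficient. -/
open scoped RealInnerProductSpace

open Polynomial in
/-- A polynomial whose root set is symmetric about zero has the parity of its degree. -/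
theorem prod_X_sub_C_coeff_eq_zero {B : Finset ℝ} (hB : ∀ a ∈ B, -a ∈ B) {k : ℕ}
    (hk : ¬ Even (B.card + k)) : (∏ a ∈ B, (X - C a)).coeff k = 0 := by
  have hcomp : (∏ a ∈ B, (X - C a)).comp (-X) = (-1) ^ B.card * ∏ a ∈ B, (X - C a) := by
    rw [Polynomial.prod_comp, ← Finset.prod_const, ← Finset.prod_mul_distrib]
    refine Finset.prod_bij' (fun a _ => -a) (fun a _ => -a) hB hB (by simp) (by simp) ?_
    intro a _
    simp only [sub_comp, X_comp, C_comp, C_neg]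
    ring
  have h := congrArg (fun p => p.coeff k) hcomp
  have hC : ((-1 : ℝ[X]) ^ B.card) = C ((-1) ^ B.card) := by simp
  have hX : (-X : ℝ[X]) = C (-1) * X := by simp
  simp only [hX, comp_C_mul_X_coeff, hC, coeff_C_mul] at h
  rcases Nat.even_or_odd k with h1 | h1 <;> rcases Nat.even_or_odd B.card with h2 | h2
  · exact absurd (h2.add h1) hk
  · rw [h1.neg_one_pow, h2.neg_one_pow] at h
    linarith
  · rw [h1.neg_one_pow, h2.neg_one_pow] at h
    linarith
  · exact absurd (h2.add_odd h1) hk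

namespace MvPolynomial

theorem finrank_homogeneousSubmodule (d n : ℕ) :
    Module.finrank ℝ (homogeneousSubmodule (Fin d) ℝ n) = (d + n - 1).choose n := by
  classical
  let e : {m : Fin d →₀ ℕ | m.degree = n} ≃ Sym (Fin d) n := (Sym.equivNatSum (Fin d) n).symm
  have : Fintype {m : Fin d →₀ ℕ | m.degree = n} := Fintype.ofEquiv _ e.symm
  rw [homogeneousSubmodule_eq_finsupp_supported,
    (AddMonoidAlgebra.supportedEquivFinsupp _).finrank_eq, Module.finrank_finsupp_self,
    Fintype.card_congr e, Sym.card_sym_eq_choose, Fintype.card_fin]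

/-- The linear form `z ↦ ⟪y, z⟫` as a polynomial. -/
noncomputable def innerForm {d : ℕ} (y : EuclideanSpace ℝ (Fin d)) : MvPolynomial (Fin d) ℝ :=
  ∑ i, C (y i) * X i

theorem eval_innerForm {d : ℕ} (y z : EuclideanSpace ℝ (Fin d)) :
    eval z (innerForm y) = ⟪y, z⟫ := by
  simp [innerForm, PiLp.inner_apply, mul_comm]

theorem isHomogeneous_innerForm {d : ℕ} (y : EuclideanSpace ℝ (Fin d)) :
    (innerForm y).IsHomogeneous 1 :=
  IsHomogeneous.sum _ _ _ fun i _ => isHomogeneous_C_mul_X (y i) i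

/-- On the unit sphere, a zonal function given by a polynomial of degree at most `n` having the
parity of `n` agrees with a homogeneous polynomial of degree `n`. -/
theorem exists_isHomogeneous_eval_eq {d n : ℕ} {f : Polynomial ℝ} (hdeg : f.natDegree ≤ n)
    (hf : ∀ k, ¬ Even (n + k) → f.coeff k = 0) (y : EuclideanSpace ℝ (Fin d)) :
    ∃ F : MvPolynomial (Fin d) ℝ, F.IsHomogeneous n ∧
      ∀ z : EuclideanSpace ℝ (Fin d), ‖z‖ = 1 → eval z F = f.eval ⟪y, z⟫ := by
  refine ⟨∑ k ∈ Finset.range (n + 1),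
    C (f.coeff k) * (innerForm y ^ k * (∑ i, X i ^ 2) ^ ((n - k) / 2)), ?_, ?_⟩
  · refine IsHomogeneous.sum _ _ _ fun k hk => ?_
    by_cases hpar : Even (n + k)
    · refine IsHomogeneous.C_mul ?_ _
      have hQ : (∑ i : Fin d, (X i : MvPolynomial (Fin d) ℝ) ^ 2).IsHomogeneous 2 :=
        IsHomogeneous.sum _ _ _ fun i _ => isHomogeneous_X_pow i 2
      convert ((isHomogeneous_innerForm y).pow k).mul (hQ.pow ((n - k) / 2)) using 1
      have := Finset.mem_range.mp hk
      have : Even (n - k) := by grind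
      grind
    · rw [hf k hpar, C_0, zero_mul]
      exact isHomogeneous_zero _ _ _
  · intro z hz
    have hQ : ∑ i, z i ^ 2 = 1 := by
      rw [← EuclideanSpace.real_norm_sq_eq, hz, one_pow]
    rw [Polynomial.eval_eq_sum_range' (Nat.lt_succ_of_le hdeg)]
    simp [eval_innerForm, hQ]

end MvPolynomial

theorem mem_innerSet {d : ℕ} {X : Finset (EuclideanSpace ℝ (Fin d))} {a : ℝ} :
    a ∈ innerSet X ↔ ∃ x ∈ X, ∃ y ∈ X, x ≠ y ∧ ⟪x, y⟫ = a := by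
  simp only [innerSet, Finset.mem_image, Finset.mem_offDiag, Prod.exists]
  grind

/-- A family of unit vectors for which a polynomial of the right parity annihilates the inner
products of distinct members but does not vanish at `1` has size at most the dimension of the
space of homogeneous polynomials. -/
theorem card_le_choose_of_eval_inner_eq_zero {d n : ℕ} {ι : Type*} [Fintype ι]
    (v : ι → EuclideanSpace ℝ (Fin d)) (hv : ∀ i, ‖v i‖ = 1) {f : Polynomial ℝ}
    (hdeg : f.natDegree ≤ n) (hf : ∀ k, ¬ Even (n + k) → f.coeff k = 0) (h1 : f.eval 1 ≠ 0)
    (h0 : ∀ i j, i ≠ j → f.eval ⟪v i, v j⟫ = 0) :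
    Fintype.card ι ≤ (d + n - 1).choose n := by
  choose F hF hFv using fun i => MvPolynomial.exists_isHomogeneous_eval_eq hdeg hf (v i)
  let G : ι → MvPolynomial.homogeneousSubmodule (Fin d) ℝ n := fun i => ⟨F i, hF i⟩
  have hli : LinearIndependent ℝ G := by
    rw [Fintype.linearIndependent_iff]
    intro g hg j
    have h : ∑ i, g i * MvPolynomial.eval (v j) (F i) = 0 := by
      simpa [G, MvPolynomial.smul_eval] using
        congrArg (fun p : MvPolynomial.homogeneousSubmodule (Fin d) ℝ n =>
          MvPolynomial.eval (v j) p.1) hg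
    rw [Finset.sum_eq_single j (fun i _ hij => by rw [hFv i _ (hv j), h0 i j hij, mul_zero])
      (by simp), hFv j _ (hv j), real_inner_self_eq_norm_sq, hv j, one_pow] at h
    exact (mul_eq_zero.mp h).resolve_right h1
  have := Module.Finite.iff_fg.mpr (MvPolynomial.homogeneousSubmodule_fg (Fin d) ℝ n)
  rw [← MvPolynomial.finrank_homogeneousSubmodule]
  exact hli.fintype_card_le_finrank

/-- **Fisher type inequality, antipodal case.** If `X` is an antipodal `s`-distance set on
the unit sphere `S^{d-1} ⊆ ℝ^d` (`d ≥ 2`, `s ≥ 1`), then `|X| ≤ 2·C(d+s-2, s-1)`. -/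
theorem fisher_type_inequality_antipodal (d s : ℕ) (hd : 2 ≤ d) (hs : 1 ≤ s)
    (X : Finset (EuclideanSpace ℝ (Fin d)))
    (hsphere : ∀ x ∈ X, ‖x‖ = 1)
    (hdist : (innerSet X).card = s)
    (hanti : ∀ x ∈ X, -x ∈ X) :
    X.card ≤ 2 * Nat.choose (d + s - 2) (s - 1) := by
  classical
  have hneg_one : (-1 : ℝ) ∈ innerSet X := by
    obtain ⟨a, ha⟩ := Finset.card_pos.mp (hdist ▸ hs)
    obtain ⟨x, hx, -⟩ := mem_innerSet.mp ha
    refine mem_innerSet.mpr ⟨x, hx, -x, hanti x hx, fun h => ?_, ?_⟩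
    · have h := congrArg (fun y => ⟪x, y⟫) h
      simp only [inner_neg_right, real_inner_self_eq_norm_sq, hsphere x hx] at h
      norm_num at h
    · rw [inner_neg_right, real_inner_self_eq_norm_sq, hsphere x hx, one_pow]
  have hone : (1 : ℝ) ∉ innerSet X := by
    intro h
    obtain ⟨x, hx, y, hy, hxy, h⟩ := mem_innerSet.mp h
    exact hxy ((inner_eq_one_iff_of_norm_eq_one (hsphere x hx) (hsphere y hy)).mp h)
  set B := (innerSet X).erase (-1)
  have hBcard : B.card = s - 1 := by rw [Finset.card_erase_of_mem hneg_one, hdist]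
  have hBneg : ∀ a ∈ B, -a ∈ B := by
    intro a ha
    obtain ⟨hne, ha⟩ := Finset.mem_erase.mp ha
    refine Finset.mem_erase.mpr ⟨fun h => hone (neg_injective h ▸ ha), ?_⟩
    obtain ⟨x, hx, y, hy, -, rfl⟩ := mem_innerSet.mp ha
    refine mem_innerSet.mpr ⟨x, hx, -y, hanti y hy, fun h => hne ?_, inner_neg_right x y⟩
    exact (inner_eq_neg_one_iff_of_norm_eq_one (hsphere x hx) (hsphere y hy)).mpr h
  let π : EuclideanSpace ℝ (Fin d) → Sym2 (EuclideanSpace ℝ (Fin d)) := fun x => s(x, -x)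
  have hπ : ∀ x, π (-x) = π x := fun x => by simp [π, Sym2.eq_swap]
  have hfib : X.card ≤ 2 * (X.image π).card := by
    refine Finset.card_le_mul_card_image _ _ fun p hp => ?_
    obtain ⟨x, -, rfl⟩ := Finset.mem_image.mp hp
    refine (Finset.card_le_card (t := {x, -x}) fun y hy => ?_).trans Finset.card_le_two
    have := (Finset.mem_filter.mp hy).2
    simp only [π, Sym2.eq_iff] at this
    simp only [Finset.mem_insert, Finset.mem_singleton]
    tauto
  have hrep : ∀ p : X.image π, ∃ x ∈ X, π x = p := fun p => Finset.mem_image.mp p.2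
  choose v hvX hv using hrep
  refine hfib.trans (Nat.mul_le_mul_left 2 ?_)
  have key := card_le_choose_of_eval_inner_eq_zero (n := s - 1) v (fun p => hsphere _ (hvX p))
    (f := ∏ a ∈ B, (Polynomial.X - Polynomial.C a))
    (by rw [Polynomial.natDegree_finsetProd_X_sub_C_eq_card, hBcard])
    (fun k hk => prod_X_sub_C_coeff_eq_zero hBneg (hBcard ▸ hk))
    (by
      rw [Polynomial.eval_prod, Finset.prod_ne_zero_iff]
      intro a ha h
      rw [Polynomial.eval_sub, Polynomial.eval_X, Polynomial.eval_C, sub_eq_zero] at h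
      exact hone (h ▸ Finset.mem_of_mem_erase ha))
    (by
      intro p q hpq
      have hmem : ⟪v p, v q⟫ ∈ B := by
        refine Finset.mem_erase.mpr ⟨fun h => hpq ?_,
          mem_innerSet.mpr ⟨_, hvX p, _, hvX q, fun h => hpq ?_, rfl⟩⟩
        · have h := (inner_eq_neg_one_iff_of_norm_eq_one
            (hsphere _ (hvX p)) (hsphere _ (hvX q))).mp h
          exact Subtype.ext (by rw [← hv p, h, hπ, hv q])
        · exact Subtype.ext (by rw [← hv p, h, hv q])
      rw [Polynomial.eval_prod]
      exact Finset.prod_eq_zero hmem (by simp))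
  rw [Fintype.card_coe] at key
  rwa [show d + s - 2 = d + (s - 1) - 1 by omega]
end

section
/- (Linear programming bound) Let X be an s-distance set on the unit sphere S^{d-1} in ℝ^d, and let F_X(t) := ∏_{α ∈ A(X)} (t − α). Write the Gegenbauer expansion F_X(t) = Σ_{k=0}^{s} f_k · G_k^{(d)}(t) with real coefficients f_k. If f_0 > 0 and f_k ≥ 0 for all 1 ≤ k ≤ s, then |X| ≤ F_X(1)/f_0. -/
open scoped RealInnerProductSpace

/-- The Gegenbauer polynomials `G_l^{(d)}`, defined by `G_0 = 1`, `G_1 = d·t` and the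
recurrence `t·G_l = λ_{l+1}·G_{l+1} + (1 - λ_{l-1})·G_{l-1}` with `λ_l = l/(d+2l-2)`. -/
noncomputable def Geg (d : ℕ) : ℕ → Polynomial ℝ
  | 0 => 1
  | 1 => Polynomial.C (d : ℝ) * Polynomial.X
  | (n+2) => Polynomial.C (((d : ℝ) + 2*(n+2) - 2)/((n : ℝ)+2)) *
      (Polynomial.X * Geg d (n+1) - Polynomial.C (1 - (n : ℝ)/((d : ℝ)+2*n-2)) * Geg d n)

section PositiveDefinite

open MvPolynomial

section Fischer

variable {σ : Type*}

/-- The Fischer form `⟨p, q⟩ = p(∂) q` evaluated at `0`, that is `∑ m, m! * p_m * q_m`. -/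
noncomputable def fischer : MvPolynomial σ ℝ →ₗ[ℝ] MvPolynomial σ ℝ →ₗ[ℝ] ℝ :=
  (basisMonomials σ ℝ).constr ℝ
    (fun m => (m.prod fun _ k => (k.factorial : ℝ)) • lcoeff ℝ m)

theorem fischer_monomial (m : σ →₀ ℕ) (a : ℝ) (q : MvPolynomial σ ℝ) :
    fischer (monomial m a) q = a * ((m.prod fun _ k => (k.factorial : ℝ)) * coeff m q) := by
  have h : monomial m a = a • basisMonomials σ ℝ m := by
    simp [coe_basisMonomials, smul_monomial]
  rw [h, map_smul, fischer, Module.Basis.constr_basis]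
  simp [lcoeff]

theorem fischer_self_nonneg (p : MvPolynomial σ ℝ) : 0 ≤ fischer p p := by
  have h : fischer p p = ∑ m ∈ p.support,
      coeff m p * ((m.prod fun _ k => (k.factorial : ℝ)) * coeff m p) := by
    have hp := congrArg (fun q => fischer q p) p.as_sum
    simpa only [map_sum, LinearMap.sum_apply, fischer_monomial] using hp
  rw [h]
  refine Finset.sum_nonneg fun m _ => ?_
  have : 0 ≤ m.prod fun _ k => (k.factorial : ℝ) :=
    Finset.prod_nonneg fun _ _ => Nat.cast_nonneg _
  nlinarith [mul_nonneg this (mul_self_nonneg (coeff m p))]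

theorem fischer_X_mul (i : σ) (p q : MvPolynomial σ ℝ) :
    fischer (X i * p) q = fischer p (pderiv i q) := by
  classical
  induction p using MvPolynomial.induction_on' with
  | add p₁ p₂ h₁ h₂ => simp only [mul_add, map_add, LinearMap.add_apply, h₁, h₂]
  | monomial m a =>
    rw [X, monomial_mul, one_mul, fischer_monomial, fischer_monomial, coeff_pderiv, add_comm]
    have h : (m + Finsupp.single i 1).prod (fun _ k => (k.factorial : ℝ)) =
        (m.prod fun _ k => (k.factorial : ℝ)) * (m i + 1) := by
      have hs : (m + Finsupp.single i 1).support = insert i m.support := by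
        ext j
        by_cases hj : j = i <;> simp [hj, eq_comm]
      have hm : (m.prod fun _ k => (k.factorial : ℝ)) =
          ∏ j ∈ insert i m.support, ((m j).factorial : ℝ) :=
        Finsupp.prod_of_support_subset _ (Finset.subset_insert _ _) _ (by simp)
      rw [hm, Finsupp.prod, hs,
        ← Finset.mul_prod_erase _ _ (Finset.mem_insert_self i m.support),
        ← Finset.mul_prod_erase _ _ (Finset.mem_insert_self i m.support)]
      have he : ∏ j ∈ (insert i m.support).erase i,
            (((m + Finsupp.single i 1 : σ →₀ ℕ) j).factorial : ℝ) =
          ∏ j ∈ (insert i m.support).erase i, ((m j).factorial : ℝ) :=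
        Finset.prod_congr rfl fun j hj => by
          simp [(Finset.ne_of_mem_erase hj).symm]
      rw [he]
      simp [Nat.factorial_succ]
      ring
    rw [h]
    ring

end Fischer

section Zonal

variable {σ : Type*} [Fintype σ]

/-- The Laplacian on polynomials. -/
noncomputable def polyLaplacian : MvPolynomial σ ℝ →ₗ[ℝ] MvPolynomial σ ℝ :=
  ∑ i, (pderiv i).toLinearMap ∘ₗ (pderiv i).toLinearMap

theorem polyLaplacian_apply (p : MvPolynomial σ ℝ) :
    polyLaplacian p = ∑ i, pderiv i (pderiv i p) := by
  simp [polyLaplacian]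

/-- The derivative of a polynomial in the direction `y`. -/
noncomputable def dirDeriv (y : σ → ℝ) (p : MvPolynomial σ ℝ) : MvPolynomial σ ℝ :=
  ∑ i, C (y i) * pderiv i p

/-- The linear form `⟨y, ·⟩`. -/
noncomputable def linForm (y : σ → ℝ) : MvPolynomial σ ℝ := ∑ i, C (y i) * X i

variable (σ) in
/-- The squared Euclidean norm as a polynomial. -/
noncomputable def normSqPoly : MvPolynomial σ ℝ := ∑ i, X i * X i

theorem pderiv_linForm (y : σ → ℝ) (i : σ) : pderiv i (linForm y) = C (y i) := by
  classical
  simp [linForm, Pi.single_apply]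

theorem pderiv_normSqPoly (i : σ) : pderiv i (normSqPoly σ) = 2 * X i := by
  classical
  simp [normSqPoly, Pi.single_apply, Finset.sum_add_distrib, two_mul]

theorem dirDeriv_mul (y : σ → ℝ) (p q : MvPolynomial σ ℝ) :
    dirDeriv y (p * q) = dirDeriv y p * q + p * dirDeriv y q := by
  simp only [dirDeriv, pderiv_mul, Finset.sum_mul, Finset.mul_sum, ← Finset.sum_add_distrib]
  exact Finset.sum_congr rfl fun i _ => by ring

theorem dirDeriv_sub (y : σ → ℝ) (p q : MvPolynomial σ ℝ) :
    dirDeriv y (p - q) = dirDeriv y p - dirDeriv y q := by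
  simp only [dirDeriv, map_sub, mul_sub, Finset.sum_sub_distrib]

theorem dirDeriv_C (y : σ → ℝ) (a : ℝ) : dirDeriv y (C a) = 0 := by
  simp [dirDeriv]

theorem dirDeriv_linForm (y : σ → ℝ) (hy : ∑ i, y i * y i = 1) :
    dirDeriv y (linForm y) = 1 := by
  simp only [dirDeriv, pderiv_linForm, ← C_mul, ← map_sum, hy, C_1]

theorem dirDeriv_normSqPoly (y : σ → ℝ) :
    dirDeriv y (normSqPoly σ) = 2 * linForm y := by
  simp only [dirDeriv, pderiv_normSqPoly, linForm, Finset.mul_sum]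
  exact Finset.sum_congr rfl fun i _ => by ring

theorem polyLaplacian_C_mul (a : ℝ) (p : MvPolynomial σ ℝ) :
    polyLaplacian (C a * p) = C a * polyLaplacian p := by
  rw [C_mul', map_smul, C_mul']

theorem polyLaplacian_linForm_mul (y : σ → ℝ) (p : MvPolynomial σ ℝ) :
    polyLaplacian (linForm y * p) = linForm y * polyLaplacian p + 2 * dirDeriv y p := by
  simp only [polyLaplacian_apply, dirDeriv, pderiv_mul, pderiv_linForm, map_add, pderiv_C,
    Finset.mul_sum, ← Finset.sum_add_distrib]
  exact Finset.sum_congr rfl fun i _ => by ring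

theorem polyLaplacian_normSqPoly_mul {p : MvPolynomial σ ℝ} {k : ℕ} (hp : p.IsHomogeneous k) :
    polyLaplacian (normSqPoly σ * p) =
      normSqPoly σ * polyLaplacian p + C (2 * (Fintype.card σ : ℝ) + 4 * k) * p := by
  have h2 (i : σ) : pderiv i (2 * X i : MvPolynomial σ ℝ) = 2 := by
    have : (2 : MvPolynomial σ ℝ) = C 2 := (map_ofNat C 2).symm
    rw [this, pderiv_C_mul, pderiv_X_self, mul_one]
  have h : ∀ i, pderiv i (pderiv i (normSqPoly σ * p)) =
      normSqPoly σ * pderiv i (pderiv i p) + (2 * p + 4 * (X i * pderiv i p)) := by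
    intro i
    simp only [pderiv_mul (f := normSqPoly σ), pderiv_mul (f := 2 * X i), pderiv_normSqPoly,
      map_add, h2]
    ring
  simp only [polyLaplacian_apply, h, Finset.sum_add_distrib, ← Finset.mul_sum,
    hp.sum_X_mul_pderiv, Finset.sum_const, Finset.card_univ, nsmul_eq_mul]
  simp only [C_add, C_mul, map_ofNat, map_natCast]
  ring

theorem fischer_linForm_mul (y : σ → ℝ) (p q : MvPolynomial σ ℝ) :
    fischer (linForm y * p) q = fischer p (dirDeriv y q) := by
  simp only [linForm, dirDeriv, Finset.sum_mul, map_sum, LinearMap.sum_apply, C_mul',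
    smul_mul_assoc, map_smul, LinearMap.smul_apply, fischer_X_mul]

theorem fischer_normSqPoly_mul (p q : MvPolynomial σ ℝ) :
    fischer (normSqPoly σ * p) q = fischer p (polyLaplacian q) := by
  simp only [normSqPoly, polyLaplacian_apply, Finset.sum_mul, map_sum, LinearMap.sum_apply,
    mul_assoc, fischer_X_mul]

theorem fischer_linForm_pow (x : σ → ℝ) (k : ℕ) {q : MvPolynomial σ ℝ}
    (hq : q.IsHomogeneous k) : fischer (linForm x ^ k) q = k.factorial * eval x q := by
  induction k generalizing q with
  | zero =>
    obtain ⟨a, rfl⟩ : ∃ a, q = C a :=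
      ⟨_, (totalDegree_eq_zero_iff_eq_C).1 ((totalDegree_zero_iff_isHomogeneous σ).2 hq)⟩
    rw [pow_zero, ← C_1, C_apply, fischer_monomial]
    simp
  | succ k ih =>
    have hd : (dirDeriv x q).IsHomogeneous k :=
      IsHomogeneous.sum _ _ _ fun i _ => by
        simpa using (isHomogeneous_C σ (x i)).mul (hq.pderiv (i := i))
    have he : eval x (dirDeriv x q) = (k + 1) * eval x q := by
      have := congrArg (eval x) hq.sum_X_mul_pderiv
      simpa [dirDeriv] using this
    rw [pow_succ', fischer_linForm_mul, ih hd, he, Nat.factorial_succ]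
    push_cast
    ring

/-- The zonal solid harmonic with pole `y`: the homogenization of the Gegenbauer polynomial
in `⟨y, ·⟩`. -/
noncomputable def zonal {d : ℕ} (y : Fin d → ℝ) : ℕ → MvPolynomial (Fin d) ℝ
  | 0 => 1
  | 1 => C (d : ℝ) * linForm y
  | (n+2) => C (((d : ℝ) + 2*(n+2) - 2)/((n : ℝ)+2)) *
      (linForm y * zonal y (n+1) -
        C (1 - (n : ℝ)/((d : ℝ)+2*n-2)) * (normSqPoly (Fin d) * zonal y n))

variable {d : ℕ} (y : Fin d → ℝ)

theorem isHomogeneous_linForm (y : σ → ℝ) : (linForm y).IsHomogeneous 1 :=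
  IsHomogeneous.sum _ _ _ fun i _ => by
    simpa using (isHomogeneous_C σ (y i)).mul (isHomogeneous_X ℝ i)

theorem isHomogeneous_normSqPoly : (normSqPoly σ).IsHomogeneous 2 :=
  IsHomogeneous.sum _ _ _ fun i _ => (isHomogeneous_X ℝ i).mul (isHomogeneous_X ℝ i)

theorem isHomogeneous_zonal : ∀ k, (zonal y k).IsHomogeneous k
  | 0 => isHomogeneous_one _ _
  | 1 => by simpa [zonal] using (isHomogeneous_C _ (d : ℝ)).mul (isHomogeneous_linForm y)
  | (n+2) => by
    have h₁ := (isHomogeneous_linForm y).mul (isHomogeneous_zonal (n+1))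
    have h₂ := (isHomogeneous_C _ (1 - (n : ℝ)/((d : ℝ)+2*n-2))).mul
      (isHomogeneous_normSqPoly.mul (isHomogeneous_zonal n))
    rw [show 1 + (n + 1) = n + 2 by ring] at h₁
    rw [show 0 + (2 + n) = n + 2 by ring] at h₂
    simpa [zonal] using (isHomogeneous_C _ (((d : ℝ) + 2*(n+2) - 2)/((n : ℝ)+2))).mul (h₁.sub h₂)

theorem eval_zonal {x : Fin d → ℝ} (hx : ∑ i, x i * x i = 1) :
    ∀ k, eval x (zonal y k) = (Geg d k).eval (∑ i, y i * x i)
  | 0 => by simp [zonal, Geg]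
  | 1 => by simp [zonal, Geg, linForm]
  | (n+2) => by
    have hl : eval x (linForm y) = ∑ i, y i * x i := by simp [linForm]
    have hn : eval x (normSqPoly (Fin d)) = 1 := by simp [normSqPoly, hx]
    simp only [zonal, Geg, map_mul, map_sub, eval_C, hl, hn, eval_zonal hx (n+1),
      eval_zonal hx n, Polynomial.eval_mul, Polynomial.eval_sub, Polynomial.eval_C,
      Polynomial.eval_X, one_mul]

theorem exists_zonal_eq (hd : 2 ≤ d) : ∀ k, ∃ a : ℝ, 0 < a ∧ ∀ y : Fin d → ℝ,
    ∃ q, zonal y k = C a * linForm y ^ k + normSqPoly (Fin d) * q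
  | 0 => ⟨1, one_pos, fun y => ⟨0, by simp [zonal]⟩⟩
  | 1 => ⟨d, by positivity, fun y => ⟨0, by simp [zonal]⟩⟩
  | (n+2) => by
    obtain ⟨a, ha, h⟩ := exists_zonal_eq hd (n+1)
    have hd' : (2 : ℝ) ≤ d := by exact_mod_cast hd
    refine ⟨((d : ℝ) + 2*(n+2) - 2)/((n : ℝ)+2) * a, ?_, fun y => ?_⟩
    · have : 0 < (d : ℝ) + 2*(n+2) - 2 := by
        have : (0 : ℝ) ≤ n := n.cast_nonneg
        linarith
      positivity
    · obtain ⟨q, hq⟩ := h y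
      refine ⟨C (((d : ℝ) + 2*(n+2) - 2)/((n : ℝ)+2)) *
        (linForm y * q - C (1 - (n : ℝ)/((d : ℝ)+2*n-2)) * zonal y n), ?_⟩
      rw [zonal, hq, C_mul]
      ring

variable {y}

theorem dirDeriv_zonal_succ (hd : 2 ≤ d) (hy : ∑ i, y i * y i = 1) :
    ∀ k : ℕ, dirDeriv y (zonal y (k+1)) =
      C ((1 - (k : ℝ)/((d : ℝ)+2*k-2)) * (d + 2*k)) * zonal y k
  | 0 => by
    rw [zero_add, zonal, zonal, dirDeriv_mul, dirDeriv_C, dirDeriv_linForm y hy]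
    simp
  | 1 => by
    have hd' : (2 : ℝ) ≤ d := by exact_mod_cast hd
    simp only [zonal, dirDeriv_mul, dirDeriv_sub, dirDeriv_C, dirDeriv_linForm y hy,
      dirDeriv_normSqPoly]
    have h1 : dirDeriv y (1 : MvPolynomial (Fin d) ℝ) = 0 := by rw [← C_1, dirDeriv_C]
    have h2 : (2 : MvPolynomial (Fin d) ℝ) = C 2 := (map_ofNat C 2).symm
    rw [h1, h2]
    have hc : ((d : ℝ) + 2*((0 : ℕ)+2) - 2)/(((0 : ℕ) : ℝ)+2) *
        (d + d - (1 - ((0 : ℕ) : ℝ)/((d : ℝ)+2*(0 : ℕ)-2)) * 2) =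
        (1 - ((1 : ℕ) : ℝ)/((d : ℝ)+2*(1 : ℕ)-2)) * (d + 2*(1 : ℕ)) * d := by
      have : (d : ℝ) ≠ 0 := by linarith
      simp
      field_simp
      ring
    have hc' := congrArg (fun r => C r * linForm y) hc
    simp only [C_mul, C_sub, C_add] at hc' ⊢
    linear_combination hc'
  | (k+2) => by
    have hd' : (2 : ℝ) ≤ d := by exact_mod_cast hd
    have hk : (0 : ℝ) ≤ k := k.cast_nonneg
    have ih₁ := dirDeriv_zonal_succ hd hy (k+1)
    have ih₀ := dirDeriv_zonal_succ hd hy k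
    have h2 : (2 : MvPolynomial (Fin d) ℝ) = C 2 := (map_ofNat C 2).symm
    rw [show k + 2 + 1 = (k + 1) + 2 by ring, zonal.eq_3]
    simp only [dirDeriv_mul, dirDeriv_sub, dirDeriv_C, dirDeriv_linForm y hy,
      dirDeriv_normSqPoly]
    rw [show k + 1 + 1 = k + 2 by ring] at ih₁ ⊢
    have hz : zonal y (k+2) = C (((d : ℝ) + 2*(k+2) - 2)/((k : ℝ)+2)) *
        (linForm y * zonal y (k+1) -
          C (1 - (k : ℝ)/((d : ℝ)+2*k-2)) * (normSqPoly (Fin d) * zonal y k)) := rfl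
    rw [ih₁, ih₀, h2, hz]
    have h₀ : (d : ℝ) + 2*k ≠ 0 := by linarith
    have h₁ : (d : ℝ) + 2*(k+1) ≠ 0 := by linarith
    have hu : ((d : ℝ) + 2*((k+1 : ℕ)+2) - 2)/(((k+1 : ℕ) : ℝ)+2) *
        (((d : ℝ) + 2*(k+2) - 2)/((k : ℝ)+2) +
          (1 - ((k+1 : ℕ) : ℝ)/((d : ℝ)+2*(k+1 : ℕ)-2)) * (d + 2*(k+1 : ℕ)) -
          (1 - ((k+1 : ℕ) : ℝ)/((d : ℝ)+2*(k+1 : ℕ)-2)) * 2) =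
        (1 - ((k+2 : ℕ) : ℝ)/((d : ℝ)+2*(k+2 : ℕ)-2)) * (d + 2*(k+2 : ℕ)) *
          (((d : ℝ) + 2*(k+2) - 2)/((k : ℝ)+2)) := by
      push_cast
      rw [show (d : ℝ) + 2*(k+1) - 2 = d + 2*k by ring,
        show (d : ℝ) + 2*(k+2) - 2 = d + 2*(k+1) by ring]
      field_simp
      ring
    have hn : ((d : ℝ) + 2*((k+1 : ℕ)+2) - 2)/(((k+1 : ℕ) : ℝ)+2) *
        (((d : ℝ) + 2*(k+2) - 2)/((k : ℝ)+2) +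
          (1 - ((k+1 : ℕ) : ℝ)/((d : ℝ)+2*(k+1 : ℕ)-2)) * (d + 2*k)) =
        (1 - ((k+2 : ℕ) : ℝ)/((d : ℝ)+2*(k+2 : ℕ)-2)) * (d + 2*(k+2 : ℕ)) *
          (((d : ℝ) + 2*(k+2) - 2)/((k : ℝ)+2)) := by
      rw [← hu]
      push_cast
      ring
    have hu' := congrArg (C (σ := Fin d)) hu
    have hn' := congrArg (C (σ := Fin d)) hn
    rw [C_mul, C_mul, C_sub, C_add, C_mul (a' := 2),
      C_mul (a' := (d : ℝ) + 2*(k+1 : ℕ))] at hu'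
    rw [C_mul, C_mul, C_add, C_mul (a' := (d : ℝ) + 2*k)] at hn'
    rw [C_mul (a' := (d : ℝ) + 2*k), C_mul (a' := (d : ℝ) + 2*(k+1 : ℕ))]
    linear_combination hu' * (linForm y * zonal y (k+1)) -
      hn' * (C (1 - (k : ℝ)/((d : ℝ)+2*k-2)) * (normSqPoly (Fin d) * zonal y k))

theorem polyLaplacian_zonal (hd : 2 ≤ d) (hy : ∑ i, y i * y i = 1) :
    ∀ k, polyLaplacian (zonal y k) = 0
  | 0 => by simp [zonal, polyLaplacian_apply]
  | 1 => by simp [zonal, polyLaplacian_apply, pderiv_linForm]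
  | (n+2) => by
    rw [zonal, polyLaplacian_C_mul, map_sub, polyLaplacian_C_mul, polyLaplacian_linForm_mul,
      polyLaplacian_normSqPoly_mul (isHomogeneous_zonal y n), polyLaplacian_zonal hd hy (n+1),
      polyLaplacian_zonal hd hy n, dirDeriv_zonal_succ hd hy]
    have h2 : (2 : MvPolynomial (Fin d) ℝ) = C 2 := (map_ofNat C 2).symm
    rw [h2, Fintype.card_fin, mul_zero, mul_zero, zero_add, zero_add, ← mul_assoc, ← mul_assoc,
      ← C_mul, ← C_mul, ← sub_mul, ← C_sub]
    ring_nf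
    simp

theorem sum_sum_eval_Geg_nonneg (hd : 2 ≤ d) (k : ℕ) (X : Finset (EuclideanSpace ℝ (Fin d)))
    (hX : ∀ x ∈ X, ‖x‖ = 1) :
    0 ≤ ∑ x ∈ X, ∑ y ∈ X, (Geg d k).eval ⟪x, y⟫ := by
  have hsq : ∀ x ∈ X, ∑ i, x i * x i = 1 := fun x hx => by
    have := EuclideanSpace.real_norm_sq_eq x
    rw [hX x hx] at this
    simpa [sq] using this.symm
  obtain ⟨a, ha, h⟩ := exists_zonal_eq hd k
  have key : ∀ x ∈ X, ∀ y ∈ X, fischer (zonal x.ofLp k) (zonal y.ofLp k) =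
      a * k.factorial * (Geg d k).eval ⟪x, y⟫ := by
    intro x hx y hy
    obtain ⟨q, hq⟩ := h x.ofLp
    rw [hq, map_add, LinearMap.add_apply, fischer_normSqPoly_mul,
      polyLaplacian_zonal hd (hsq y hy), map_zero, add_zero, C_mul', map_smul,
      LinearMap.smul_apply, fischer_linForm_pow _ _ (isHomogeneous_zonal _ k),
      eval_zonal _ (hsq x hx), smul_eq_mul, mul_assoc]
    simp [PiLp.inner_apply]
  have hpos : (0 : ℝ) < a * k.factorial := by positivity
  refine nonneg_of_mul_nonneg_right (a := a * k.factorial) ?_ hpos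
  have := fischer_self_nonneg (∑ x ∈ X, zonal x.ofLp k)
  simp only [map_sum, LinearMap.sum_apply] at this
  rw [Finset.sum_comm] at this
  rw [Finset.mul_sum]
  refine this.trans_eq (Finset.sum_congr rfl fun x hx => ?_)
  rw [Finset.mul_sum]
  exact Finset.sum_congr rfl fun y hy => key x hx y hy

end Zonal

end PositiveDefinite

/-- **Linear programming bound.** Let `X` be an `s`-distance set on `S^{d-1}` and
`F_X(t) = ∏_{α ∈ A(X)} (t - α) = Σ_{k=0}^s f_k G_k^{(d)}(t)` its Gegenbauer expansion.
If `f_0 > 0` and `f_k ≥ 0` for all `1 ≤ k ≤ s`, then `|X| ≤ F_X(1)/f_0`. -/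
theorem linear_programming_bound (d s : ℕ) (hd : 2 ≤ d)
    (X : Finset (EuclideanSpace ℝ (Fin d)))
    (hsphere : ∀ x ∈ X, ‖x‖ = 1)
    (hdist : (innerSet X).card = s)
    (f : ℕ → ℝ)
    (hexp : ∏ α ∈ innerSet X, (Polynomial.X - Polynomial.C α) =
      ∑ k ∈ Finset.range (s + 1), Polynomial.C (f k) * Geg d k)
    (hf0 : 0 < f 0)
    (hfk : ∀ k, 1 ≤ k → k ≤ s → 0 ≤ f k) :
    (X.card : ℝ) ≤ (∏ α ∈ innerSet X, (Polynomial.X - Polynomial.C α)).eval 1 / f 0 := by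
  classical
  set F := ∏ α ∈ innerSet X, (Polynomial.X - Polynomial.C α) with hF
  have hdiag : ∀ x ∈ X, ∑ y ∈ X, F.eval ⟪x, y⟫ = F.eval 1 := by
    intro x hx
    rw [Finset.sum_eq_single_of_mem x hx, real_inner_self_eq_norm_sq, hsphere x hx, one_pow]
    intro y hy hyx
    rw [hF, Polynomial.eval_prod]
    refine Finset.prod_eq_zero (i := ⟪x, y⟫) ?_ (by simp)
    simp only [innerSet, Finset.mem_image, Finset.mem_offDiag]
    exact ⟨(x, y), ⟨hx, hy, hyx.symm⟩, rfl⟩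
  have hsum : ∑ x ∈ X, ∑ y ∈ X, F.eval ⟪x, y⟫ = X.card * F.eval 1 := by
    rw [Finset.sum_congr rfl hdiag, Finset.sum_const, nsmul_eq_mul]
  have hlow : f 0 * (X.card : ℝ) ^ 2 ≤ ∑ x ∈ X, ∑ y ∈ X, F.eval ⟪x, y⟫ := by
    have hswap : ∑ x ∈ X, ∑ y ∈ X, F.eval ⟪x, y⟫ =
        ∑ k ∈ Finset.range (s + 1), f k * ∑ x ∈ X, ∑ y ∈ X, (Geg d k).eval ⟪x, y⟫ := by
      simp only [hexp, Polynomial.eval_finsetSum, Polynomial.eval_mul, Polynomial.eval_C,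
        Finset.mul_sum]
      rw [Finset.sum_comm (s := Finset.range (s + 1))]
      exact Finset.sum_congr rfl fun x _ => Finset.sum_comm
    rw [hswap, Finset.sum_range_succ']
    have h0 : ∑ x ∈ X, ∑ y ∈ X, (Geg d 0).eval ⟪x, y⟫ = (X.card : ℝ) ^ 2 := by
      simp [Geg, sq]
    rw [h0]
    refine le_add_of_nonneg_left (Finset.sum_nonneg fun k hk => ?_)
    exact mul_nonneg (hfk _ (Nat.le_add_left 1 k) (Finset.mem_range.1 hk))
      (sum_sum_eval_Geg_nonneg hd _ X hsphere)
  rw [le_div_iff₀ hf0]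
  rcases X.eq_empty_or_nonempty with rfl | hne
  · simp [hF, innerSet]
  · have hc : (0 : ℝ) < X.card := by exact_mod_cast hne.card_pos
    refine le_of_mul_le_mul_left ?_ hc
    rw [← hsum]
    linarith
end

section
/- Let M be a real symmetric n × n matrix and N a real m × n matrix. Suppose N · M · Nᵀ = D, where D is an m × m diagonal matrix having exactly u positive diagonal entries and exactly v negative diagonal entries. Then the number of positive eigenvalues of M (counted with multiplicity) is at least u, and the number of negative eigenvalues of M (counted with multiplicity) is at least v. -/
open Matrix in
/-- If a diagonal form with coefficients `e` pulls back along `B` to a diagonal form with positive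
coefficients, then `e` has at least as many positive entries as the pulled back form. -/
theorem Matrix.card_le_card_pos_of_mul_diagonal_mul_transpose {p n : Type*}
    [Fintype p] [DecidableEq p] [Fintype n] [DecidableEq n]
    (B : Matrix p n ℝ) (e : n → ℝ) (d : p → ℝ) (hd : ∀ i, 0 < d i)
    (h : B * diagonal e * Bᵀ = diagonal d) :
    Fintype.card p ≤ Fintype.card {j // 0 < e j} := by
  let f : (p → ℝ) →ₗ[ℝ] ({j // 0 < e j} → ℝ) := (Bᵀ.submatrix Subtype.val id).mulVecLin
  have hf : Function.Injective f := by
    rw [injective_iff_map_eq_zero]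
    intro x hx
    have key : ∑ i, d i * x i ^ 2 = ∑ j, e j * (Bᵀ *ᵥ x) j ^ 2 := by
      have h' : x ⬝ᵥ (diagonal d *ᵥ x) = (Bᵀ *ᵥ x) ⬝ᵥ (diagonal e *ᵥ (Bᵀ *ᵥ x)) := by
        rw [← h, ← mulVec_mulVec, ← mulVec_mulVec, dotProduct_mulVec, mulVec_transpose]
      simp only [dotProduct, mulVec_diagonal] at h'
      convert h' using 2 <;> ring
    have hle : ∑ j, e j * (Bᵀ *ᵥ x) j ^ 2 ≤ 0 := by
      refine Finset.sum_nonpos fun j _ => ?_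
      by_cases hj : 0 < e j
      · have h0 : (Bᵀ *ᵥ x) j = 0 := congrFun hx ⟨j, hj⟩
        simp [h0]
      · exact mul_nonpos_of_nonpos_of_nonneg (not_lt.mp hj) (sq_nonneg _)
    have hnn : ∀ i ∈ Finset.univ, 0 ≤ d i * x i ^ 2 := fun i _ =>
      mul_nonneg (hd i).le (sq_nonneg _)
    have hz := (Finset.sum_eq_zero_iff_of_nonneg hnn).mp
      (le_antisymm (key.trans_le hle) (Finset.sum_nonneg hnn))
    funext i
    simpa [(hd i).ne'] using hz i (Finset.mem_univ i)
  simpa using LinearMap.finrank_le_finrank_of_injective hf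

open Matrix in
/-- If a diagonal form with coefficients `e` pulls back along `B` to a diagonal form with
coefficients `d`, then `e` has at least as many positive entries as `d`. -/
theorem Matrix.card_pos_le_card_pos_of_mul_diagonal_mul_transpose {m n : Type*}
    [Fintype m] [DecidableEq m] [Fintype n] [DecidableEq n]
    (B : Matrix m n ℝ) (e : n → ℝ) (d : m → ℝ) (h : B * diagonal e * Bᵀ = diagonal d) :
    Fintype.card {i // 0 < d i} ≤ Fintype.card {j // 0 < e j} := by
  refine card_le_card_pos_of_mul_diagonal_mul_transpose
    (B.submatrix (Subtype.val : {i // 0 < d i} → m) id) e (fun i => d i) (fun i => i.2) ?_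
  have hs := congrArg (fun A => A.submatrix
    (Subtype.val : {i // 0 < d i} → m) (Subtype.val : {i // 0 < d i} → m)) h
  rw [submatrix_diagonal _ _ Subtype.val_injective] at hs
  exact hs

open scoped Classical in
/-- If `M` is a real symmetric `n × n` matrix, `N` an `m × n` real matrix, and
`N * M * Nᵀ` is a diagonal matrix with exactly `u` positive and exactly `v` negative
diagonal entries, then `M` has at least `u` positive and at least `v` negative
eigenvalues (counted with multiplicity). -/
theorem eigenvalue_count_lower_bound (n m : ℕ)
    (M : Matrix (Fin n) (Fin n) ℝ) (hM : M.IsHermitian)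
    (N : Matrix (Fin m) (Fin n) ℝ)
    (dvec : Fin m → ℝ) (u v : ℕ)
    (hu : (Finset.univ.filter (fun i => 0 < dvec i)).card = u)
    (hv : (Finset.univ.filter (fun i => dvec i < 0)).card = v)
    (hEq : N * M * N.transpose = Matrix.diagonal dvec) :
    u ≤ (Finset.univ.filter (fun i => 0 < hM.eigenvalues i)).card ∧
    v ≤ (Finset.univ.filter (fun i => hM.eigenvalues i < 0)).card := by
  have hB : (N * (hM.eigenvectorUnitary : Matrix (Fin n) (Fin n) ℝ)) *
      Matrix.diagonal hM.eigenvalues *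
      (N * (hM.eigenvectorUnitary : Matrix (Fin n) (Fin n) ℝ)).transpose =
      Matrix.diagonal dvec := by
    have hs := hM.spectral_theorem
    rw [Unitary.conjStarAlgAut_apply] at hs
    rw [← hEq]
    conv_rhs => rw [hs]
    simp only [Matrix.transpose_mul, Matrix.mul_assoc, Matrix.star_eq_conjTranspose,
      Matrix.conjTranspose_eq_transpose_of_trivial]
    rfl
  subst hu hv
  refine ⟨?_, ?_⟩
  · have h := Matrix.card_pos_le_card_pos_of_mul_diagonal_mul_transpose _ _ _ hB
    simpa only [Fintype.card_subtype] using h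
  · have h := Matrix.card_pos_le_card_pos_of_mul_diagonal_mul_transpose
      (N * (hM.eigenvectorUnitary : Matrix (Fin n) (Fin n) ℝ)) (-hM.eigenvalues) (-dvec) (by
        have hneg {k : ℕ} (w : Fin k → ℝ) : Matrix.diagonal (-w) = -Matrix.diagonal w :=
          (Matrix.diagonal_neg w).symm
        rw [hneg, hneg, Matrix.mul_neg, Matrix.neg_mul, hB])
    simpa only [Fintype.card_subtype, Pi.neg_apply, Left.neg_pos_iff] using h
end
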